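/- arXiv:2412.04271 — 2 statements merged into one kernel-verified Lean document; each statement's English description precedes it below -/
import Mathlib

section
/- Assume gcd(N, M) = 1 and let ρ : Matrix S S ℂ be positive semidefinite with trace(ρ) = 1. Then the HW-reduced density matrix ρ_HW is positive semidefinite and has trace(ρ_HW) = 1. -/
open Matrix Complex BigOperators Finset
open scoped ComplexOrder

noncomputable section

set_option linter.unusedVariables false

/-- `ω = exp(2πi/M)`. -/
def hwOmega (M : ℕ) : ℂ := Complex.exp (2 * Real.pi * Complex.I / M)

/-- Single-photon Heisenberg–Weyl matrix `L_{k,l} = X^k Z^l`,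
with entries `L_{k,l}[m,m'] = ω^{l·m'}` if `m = m' + k` and `0` otherwise. -/
def HW (M : ℕ) [NeZero M] (k l : ZMod M) : Matrix (ZMod M) (ZMod M) ℂ :=
  Matrix.of fun m m' => if m = m' + k then hwOmega M ^ (l * m').val else 0

/-- Fock vectors: mode-occupation functions `ZMod M → ℕ` with total photon number `N`. -/
abbrev Fock (M N : ℕ) [NeZero M] := {n : ZMod M → ℕ // ∑ m, n m = N}

instance (M N : ℕ) [NeZero M] : Fintype (Fock M N) :=
  Fintype.ofInjective
    (fun n (m : ZMod M) => (⟨n.1 m, Nat.lt_succ_of_le (le_of_le_of_eq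
      (Finset.single_le_sum (fun i _ => Nat.zero_le _) (Finset.mem_univ m)) n.2)⟩ : Fin (N+1)))
    (fun a b h => Subtype.ext (funext fun m => congrArg Fin.val (congrFun h m)))

/-- The mode shift `σ`, `(σ n)(m) = n(m - 1)`. -/
def modeShift (M N : ℕ) [NeZero M] (n : Fock M N) : Fock M N :=
  ⟨fun m => n.1 (m - 1), by
    exact (Fintype.sum_equiv (Equiv.subRight (1 : ZMod M)) _ _ (fun m => rfl)).trans n.2⟩

/-- The total mode index `μ(n) = ∑ m, m·n(m) ∈ ZMod M`. -/
def tmi (M N : ℕ) [NeZero M] (n : Fock M N) : ZMod M := ∑ m : ZMod M, m * (n.1 m : ZMod M)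

/-- The HW-reduced density matrix,
`ρ_HW[m,m'] = ∑_{ñ ∈ S, μ(ñ) = 0} ρ[σ^m ñ, σ^{m'} ñ]`. -/
def rhoHW (M N : ℕ) [NeZero M] (ρ : Matrix (Fock M N) (Fock M N) ℂ) :
    Matrix (ZMod M) (ZMod M) ℂ :=
  Matrix.of fun m m' => ∑ t : Fock M N,
    if tmi M N t = 0 then ρ ((modeShift M N)^[m.val] t) ((modeShift M N)^[m'.val] t) else 0

theorem modeShift_bijective (M N : ℕ) [NeZero M] : Function.Bijective (modeShift M N) := by
  refine Finite.injective_iff_bijective.mp fun a b h => Subtype.ext (funext fun m => ?_)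
  simpa [modeShift] using congrFun (congrArg Subtype.val h) (m + 1)

theorem tmi_modeShift (M N : ℕ) [NeZero M] (n : Fock M N) :
    tmi M N (modeShift M N n) = tmi M N n + N := by
  have hn : (N : ZMod M) = ∑ m, (n.1 m : ZMod M) := by
    rw [← Nat.cast_sum, n.2]
  rw [hn, tmi, tmi, ← Finset.sum_add_distrib]
  refine Fintype.sum_equiv (Equiv.subRight (1 : ZMod M)) _ _ fun m => ?_
  simp only [modeShift, Equiv.subRight_apply]
  ring

theorem tmi_modeShift_iterate (M N : ℕ) [NeZero M] (k : ℕ) (n : Fock M N) :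
    tmi M N ((modeShift M N)^[k] n) = tmi M N n + k * N := by
  induction k with
  | zero => simp
  | succ k ih =>
    rw [Function.iterate_succ_apply', tmi_modeShift, ih]
    push_cast
    ring

theorem rhoHW_posSemidef (M N : ℕ) [NeZero M] {ρ : Matrix (Fock M N) (Fock M N) ℂ}
    (hρ : ρ.PosSemidef) : (rhoHW M N ρ).PosSemidef := by
  have h : rhoHW M N ρ = ∑ t : Fock M N with tmi M N t = 0,
      ρ.submatrix (fun m : ZMod M => (modeShift M N)^[m.val] t)
        (fun m : ZMod M => (modeShift M N)^[m.val] t) := by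
    ext m m'
    simp [rhoHW, Matrix.sum_apply, Finset.sum_filter]
  rw [h]
  exact Matrix.posSemidef_sum _ fun t _ => hρ.submatrix _

theorem trace_rhoHW (M N : ℕ) [NeZero M] (hgcd : Nat.gcd N M = 1)
    (ρ : Matrix (Fock M N) (Fock M N) ℂ) :
    Matrix.trace (rhoHW M N ρ) = Matrix.trace ρ := by
  have hN : IsUnit (N : ZMod M) := (ZMod.isUnit_iff_coprime N M).mpr hgcd
  have hsector (m : ZMod M) : rhoHW M N ρ m m =
      ∑ n : Fock M N, if m * N = tmi M N n then ρ n n else 0 := by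
    rw [← ((modeShift_bijective M N).iterate m.val).sum_comp]
    simp [rhoHW, tmi_modeShift_iterate]
  have hmul : Function.Bijective fun m : ZMod M => m * (N : ZMod M) :=
    Finite.injective_iff_bijective.mp hN.mul_left_injective
  simp only [Matrix.trace, Matrix.diag_apply, hsector]
  rw [Finset.sum_comm]
  refine Finset.sum_congr rfl fun n _ => ?_
  rw [hmul.sum_comp fun x => if x = tmi M N n then ρ n n else 0]
  simp

/-- the HW-reduced density matrix of a state (positive semidefinite, trace one)
is again a state. -/
theorem rhoHW_posSemidef_trace_one (M N : ℕ) [NeZero M] (hN : 1 ≤ N)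
    (hgcd : Nat.gcd N M = 1) (ρ : Matrix (Fock M N) (Fock M N) ℂ)
    (hρ : ρ.PosSemidef) (htr : Matrix.trace ρ = 1) :
    (rhoHW M N ρ).PosSemidef ∧ Matrix.trace (rhoHW M N ρ) = 1 := by
  exact ⟨rhoHW_posSemidef M N hρ, (trace_rhoHW M N hgcd ρ).trans htr⟩

end
end

section
/- Let k, l ∈ ZMod M, let ν, n ∈ S, and let f, g : Fin N → ZMod M be enumerations of ν and n respectively. Then the permanent of the N×N matrix B with B i j = L_{k,l}[f i, g j] equals ω^{l·μ(n)} · ∏_m (n(m))! if ν = σ^k n, and equals 0 otherwise. Consequently the N-photon matrix element of the mode matrix L_{k,l} is Γ(L_{k,l})[ν,n] = ω^{l·μ(n)} if ν = σ^k n and 0 otherwise. -/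
open Matrix Complex BigOperators Finset

noncomputable section

set_option linter.unusedVariables false

/-- Multiphoton Heisenberg–Weyl matrix `Λ_{k,l}`, with entries `ω^{l·μ(n)}` at `(σ^k n, n)`
and `0` elsewhere. -/
def HWm (M N : ℕ) [NeZero M] (k l : ZMod M) : Matrix (Fock M N) (Fock M N) ℂ :=
  Matrix.of fun v n =>
    if v = (modeShift M N)^[k.val] n then hwOmega M ^ (l * tmi M N n).val else 0

/-- `f : Fin N → ZMod M` enumerates the Fock vector `n`: each fiber `f⁻¹{m}` has `n(m)` elements. -/
def IsEnum (M N : ℕ) [NeZero M] (n : Fock M N) (f : Fin N → ZMod M) : Prop :=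
  ∀ m : ZMod M, (Finset.univ.filter fun i => f i = m).card = n.1 m

theorem hwOmega_pow_card (M : ℕ) [NeZero M] : hwOmega M ^ M = 1 := by
  have hM : (M : ℂ) ≠ 0 := Nat.cast_ne_zero.mpr (NeZero.ne M)
  rw [hwOmega, ← Complex.exp_nat_mul, mul_div_cancel₀ _ hM, Complex.exp_two_pi_mul_I]

theorem hwOmega_pow_val_add (M : ℕ) [NeZero M] (a b : ZMod M) :
    hwOmega M ^ (a + b).val = hwOmega M ^ a.val * hwOmega M ^ b.val := by
  rw [ZMod.val_add, ← pow_add, ← pow_eq_pow_mod _ (hwOmega_pow_card M)]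

theorem prod_hwOmega_pow_val (M : ℕ) [NeZero M] {ι : Type*} (s : Finset ι) (a : ι → ZMod M) :
    ∏ i ∈ s, hwOmega M ^ (a i).val = hwOmega M ^ (∑ i ∈ s, a i).val := by
  classical
  induction s using Finset.induction_on with
  | empty => simp
  | insert i s hi ih => rw [prod_insert hi, sum_insert hi, hwOmega_pow_val_add, ih]

theorem modeShift_iterate_apply (M N : ℕ) [NeZero M] (n : Fock M N) (j : ℕ) (m : ZMod M) :
    ((modeShift M N)^[j] n).1 m = n.1 (m - j) := by
  induction j generalizing m with
  | zero => simp
  | succ j ih =>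
    rw [Function.iterate_succ_apply']
    change ((modeShift M N)^[j] n).1 (m - 1) = _
    rw [ih, Nat.cast_succ, sub_sub, add_comm (1 : ZMod M)]

theorem IsEnum.sum_eq_tmi {M N : ℕ} [NeZero M] {n : Fock M N} {g : Fin N → ZMod M}
    (hg : IsEnum M N n g) : ∑ i, g i = tmi M N n := by
  rw [tmi, ← Finset.sum_fiberwise univ g]
  refine sum_congr rfl fun m _ => ?_
  rw [sum_congr rfl fun i hi => (mem_filter.mp hi).2, sum_const, hg m, nsmul_eq_mul, mul_comm]

/-- Shifting an enumeration of `n` by `k` enumerates `σ^k n`. -/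
theorem IsEnum.add_const {M N : ℕ} [NeZero M] {n : Fock M N} {g : Fin N → ZMod M}
    (hg : IsEnum M N n g) (k : ZMod M) :
    IsEnum M N ((modeShift M N)^[k.val] n) fun i => g i + k := by
  intro m
  rw [modeShift_iterate_apply, ZMod.natCast_zmod_val, ← hg]
  simp only [eq_sub_iff_add_eq]

theorem IsEnum.exists_perm {M N : ℕ} [NeZero M] {n : Fock M N} {f h : Fin N → ZMod M}
    (hf : IsEnum M N n f) (hh : IsEnum M N n h) :
    ∃ e : Equiv.Perm (Fin N), ∀ i, f (e i) = h i := by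
  have key (c : ZMod M) : Nonempty ({i // h i = c} ≃ {i // f i = c}) := by
    refine ⟨Fintype.equivOfCardEq ?_⟩
    rw [Fintype.card_subtype, Fintype.card_subtype, hf c, hh c]
  exact ⟨Equiv.ofFiberEquiv fun c => (key c).some, Equiv.ofFiberEquiv_map _⟩

theorem IsEnum.eq_of_perm {M N : ℕ} [NeZero M] {ν n : Fock M N} {f h : Fin N → ZMod M}
    (hf : IsEnum M N ν f) (hh : IsEnum M N n h) (e : Equiv.Perm (Fin N))
    (he : ∀ i, f (e i) = h i) : ν = n := by
  refine Subtype.ext (funext fun m => ?_)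
  rw [← hf m, ← hh m]
  refine (card_equiv e fun i => ?_).symm
  simp [he]

/-- The number of permutations carrying one enumeration of `n` to another is `∏ m, n(m)!`. -/
theorem IsEnum.card_perm {M N : ℕ} [NeZero M] {n : Fock M N} {f h : Fin N → ZMod M}
    (hf : IsEnum M N n f) (hh : IsEnum M N n h) :
    (univ.filter fun τ : Equiv.Perm (Fin N) => ∀ i, f (τ i) = h i).card =
      ∏ m, Nat.factorial (n.1 m) := by
  obtain ⟨e, he⟩ := hf.exists_perm hh
  have hcard := DomMulAct.stabilizer_card f
  simp only [Fintype.card_subtype] at hcard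
  rw [← prod_congr rfl fun m _ => congrArg Nat.factorial (hf m), ← hcard]
  refine card_equiv (Equiv.mulRight e⁻¹) fun τ => ?_
  simp only [mem_filter, mem_univ, true_and, Equiv.coe_mulRight, funext_iff, Function.comp_apply,
    Equiv.Perm.mul_apply]
  constructor
  · intro H i
    rw [H, ← he, ← Equiv.Perm.mul_apply, mul_inv_cancel, Equiv.Perm.one_apply]
  · intro H i
    simpa [he] using H (e i)

theorem prod_factorial_modeShift_iterate (M N : ℕ) [NeZero M] (n : Fock M N) (j : ℕ) :
    ∏ m, Nat.factorial (((modeShift M N)^[j] n).1 m) = ∏ m, Nat.factorial (n.1 m) := by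
  simp only [modeShift_iterate_apply]
  exact Fintype.prod_equiv (Equiv.subRight (j : ZMod M)) _ _ fun _ => rfl

theorem permanent_HW (M N : ℕ) [NeZero M] (k l : ZMod M) (ν n : Fock M N)
    (f g : Fin N → ZMod M) (hf : IsEnum M N ν f) (hg : IsEnum M N n g) :
    Matrix.permanent (Matrix.of fun i j : Fin N => HW M k l (f i) (g j)) =
      if ν = (modeShift M N)^[k.val] n then
        hwOmega M ^ (l * tmi M N n).val * ((∏ m, Nat.factorial (n.1 m) : ℕ) : ℂ) else 0 := by
  have hh := hg.add_const k
  have hterm (τ : Equiv.Perm (Fin N)) : ∏ i, HW M k l (f (τ i)) (g i) =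
      if ∀ i, f (τ i) = g i + k then hwOmega M ^ (l * tmi M N n).val else 0 := by
    simp only [HW, Matrix.of_apply]
    rw [Finset.prod_ite_zero, prod_hwOmega_pow_val, ← mul_sum, hg.sum_eq_tmi]
    simp
  simp only [Matrix.permanent, Matrix.of_apply, hterm]
  split_ifs with hν
  · subst hν
    rw [← sum_filter, sum_const, hf.card_perm hh, prod_factorial_modeShift_iterate,
      nsmul_eq_mul, mul_comm]
  · exact sum_eq_zero fun τ _ => if_neg fun H => hν (hf.eq_of_perm hh τ H)

/-- the permanent computing the `N`-photon matrix element of `L_{k,l}` equals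
`ω^{l·μ(n)} · ∏_m n(m)!` if `ν = σ^k n` and `0` otherwise; consequently
`Γ(L_{k,l})[ν,n] = ω^{l·μ(n)} · 𝟙[ν = σ^k n]`. -/
theorem permanent_HW_matrix_element (M N : ℕ) [NeZero M] (hN : 1 ≤ N) (k l : ZMod M)
    (ν n : Fock M N) (f g : Fin N → ZMod M)
    (hf : IsEnum M N ν f) (hg : IsEnum M N n g) :
    Matrix.permanent (Matrix.of fun i j : Fin N => HW M k l (f i) (g j)) =
      (if ν = (modeShift M N)^[k.val] n then
        hwOmega M ^ (l * tmi M N n).val * ((∏ m, Nat.factorial (n.1 m) : ℕ) : ℂ) else 0) ∧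
    Matrix.permanent (Matrix.of fun i j : Fin N => HW M k l (f i) (g j)) /
        (Real.sqrt (((∏ m, Nat.factorial (ν.1 m)) * ∏ m, Nat.factorial (n.1 m) : ℕ)) : ℂ) =
      (if ν = (modeShift M N)^[k.val] n then hwOmega M ^ (l * tmi M N n).val else 0) := by
  have hperm := permanent_HW M N k l ν n f g hf hg
  refine ⟨hperm, ?_⟩
  rw [hperm]
  split_ifs with hν
  · have hne : ((∏ m, Nat.factorial (n.1 m) : ℕ) : ℂ) ≠ 0 :=
      Nat.cast_ne_zero.mpr (prod_ne_zero_iff.mpr fun m _ => Nat.factorial_ne_zero _)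
    rw [hν, prod_factorial_modeShift_iterate, Nat.cast_mul,
      Real.sqrt_mul_self (Nat.cast_nonneg _), Complex.ofReal_natCast, mul_div_cancel_right₀ _ hne]
  · exact zero_div _

end
end
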